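/- For every n ≥ 0 and every f ∈ Q_{n+1}: (i) for every word w of length k ≤ n+1 over {1,2,3}, the restriction π_w(f) belongs to Q_{n+1−k} (i.e., it is a spanning forest of G_{n+1−k} with at most three components, each containing a corner vertex); (ii) Tr f ∈ Q_n, and the trace maps T_{n+1}^i onto T_n^i, S_{n+1}^i onto S_n^i (i ∈ {1,2,3}), and R_{n+1} onto R_n. -/

import Mathlib

attribute [local instance] Classical.propDecidable

noncomputable section

/-- Points in the plane. -/
abbrev Pt : Type := ℝ × ℝ

/-- The three corner vertices `u₁ = (0,0)`, `u₂ = (1,0)`, `u₃ = (1/2, √3/2)`. -/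
def cornerPt : Fin 3 → Pt
  | 0 => (0, 0)
  | 1 => (1, 0)
  | 2 => (1 / 2, Real.sqrt 3 / 2)

/-- The similitude `ψ_i(x) = (x + u_i)/2`. -/
def psi (i : Fin 3) (x : Pt) : Pt := ((x.1 + (cornerPt i).1) / 2, (x.2 + (cornerPt i).2) / 2)

/-- Vertex set of the Sierpiński graph `G_n`. -/
def sierpV : ℕ → Finset Pt
  | 0 => {cornerPt 0, cornerPt 1, cornerPt 2}
  | n + 1 => (sierpV n).image (psi 0) ∪ (sierpV n).image (psi 1) ∪ (sierpV n).image (psi 2)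

/-- Edge set of the Sierpiński graph `G_n`. -/
def sierpE : ℕ → Finset (Sym2 Pt)
  | 0 => {s(cornerPt 0, cornerPt 1), s(cornerPt 1, cornerPt 2), s(cornerPt 2, cornerPt 0)}
  | n + 1 =>
      (sierpE n).image (Sym2.map (psi 0)) ∪ (sierpE n).image (Sym2.map (psi 1)) ∪
        (sierpE n).image (Sym2.map (psi 2))

/-- The simple graph spanned by a finite set of edges. -/
def graphOf (F : Finset (Sym2 Pt)) : SimpleGraph Pt := SimpleGraph.fromEdgeSet ↑F

/-- Spanning trees of `G_n`: acyclic edge subsets connecting all vertices of `G_n`. -/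
def treeSet (n : ℕ) : Finset (Finset (Sym2 Pt)) :=
  (sierpE n).powerset.filter fun F =>
    (graphOf F).IsAcyclic ∧ ∀ x ∈ sierpV n, ∀ y ∈ sierpV n, (graphOf F).Reachable x y

/-- `S_n^i` (with `i : Fin 3` zero-based): spanning forests of `G_n` with exactly two
components, one containing corner `i`, the other containing the two remaining corners. -/
def twoForestSet (n : ℕ) (i : Fin 3) : Finset (Finset (Sym2 Pt)) :=
  (sierpE n).powerset.filter fun F =>
    (graphOf F).IsAcyclic ∧
    (∀ j, j ≠ i → ¬ (graphOf F).Reachable (cornerPt i) (cornerPt j)) ∧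
    (∀ j k, j ≠ i → k ≠ i → (graphOf F).Reachable (cornerPt j) (cornerPt k)) ∧
    (∀ x ∈ sierpV n, ∃ j, (graphOf F).Reachable (cornerPt j) x)

/-- `R_n`: spanning forests of `G_n` with exactly three components, each containing
exactly one corner vertex. -/
def threeForestSet (n : ℕ) : Finset (Finset (Sym2 Pt)) :=
  (sierpE n).powerset.filter fun F =>
    (graphOf F).IsAcyclic ∧
    (∀ j k, j ≠ k → ¬ (graphOf F).Reachable (cornerPt j) (cornerPt k)) ∧
    (∀ x ∈ sierpV n, ∃ j, (graphOf F).Reachable (cornerPt j) x)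

/-- Edges of the copy `ψ_i(G_n)` inside `G_{n+1}`. -/
def psiCellE (i : Fin 3) (n : ℕ) : Finset (Sym2 Pt) := (sierpE n).image (Sym2.map (psi i))

/-- The class `T_n^i`: for `n ≥ 1`, spanning trees whose unique path from corner `i`
to any other corner `j` stays in `ψ_i(G_{n-1}) ∪ ψ_j(G_{n-1})`; for `n = 0` the
singleton consisting of the two edges of `G_0` incident with corner `i`. -/
def treeClass : ℕ → Fin 3 → Finset (Finset (Sym2 Pt))
  | 0, i => {(sierpE 0).filter fun e => cornerPt i ∈ e}
  | n + 1, i =>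
      (treeSet (n + 1)).filter fun F =>
        ∀ j, j ≠ i → ∀ p : (graphOf F).Walk (cornerPt i) (cornerPt j), p.IsPath →
          ∀ e ∈ p.edges, e ∈ psiCellE i n ∪ psiCellE j n

/-- `ψ_w = ψ_{w₁} ∘ ⋯ ∘ ψ_{w_k}` for a word `w` of length `k`. -/
def psiWord {k : ℕ} (w : Fin k → Fin 3) : Pt → Pt :=
  (List.ofFn w).foldr (fun i g => psi i ∘ g) id

/-- The restriction `π_w(F) = ψ_w^{-1}(F ∩ ψ_w(G_{m-k}))` of an edge set `F ⊆ E G_m`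
to the `k`-part indexed by the word `w`, as a subgraph of `G_{m-k}`. -/
def restrictE {k : ℕ} (w : Fin k → Fin 3) (m : ℕ) (F : Finset (Sym2 Pt)) :
    Finset (Sym2 Pt) :=
  (sierpE (m - k)).filter fun e => Sym2.map (psiWord w) e ∈ F

/-- Number of connected components of the subgraph with edge set `F`,
on the vertex set of `G_m`. -/
def ncomp (m : ℕ) (F : Finset (Sym2 Pt)) : ℕ :=
  Set.ncard {C : Set Pt | ∃ v ∈ sierpV m, C = {x : Pt | x ∈ sierpV m ∧ (graphOf F).Reachable v x}}

/-- Degree of `v` in the edge set `F`. -/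
def degIn (F : Finset (Sym2 Pt)) (v : Pt) : ℕ := (F.filter fun e => v ∈ e).card

/-- The subgraph of `G_0` replacing a forest in `Q_1`, used in the trace construction. -/
def traceCell (g : Finset (Sym2 Pt)) : Finset (Sym2 Pt) :=
  if g ∈ treeClass 1 0 then (sierpE 0).filter (fun e => cornerPt 0 ∈ e)
  else if g ∈ treeClass 1 1 then (sierpE 0).filter (fun e => cornerPt 1 ∈ e)
  else if g ∈ treeClass 1 2 then (sierpE 0).filter (fun e => cornerPt 2 ∈ e)
  else if g ∈ twoForestSet 1 0 then (sierpE 0).filter (fun e => cornerPt 0 ∉ e)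
  else if g ∈ twoForestSet 1 1 then (sierpE 0).filter (fun e => cornerPt 1 ∉ e)
  else if g ∈ twoForestSet 1 2 then (sierpE 0).filter (fun e => cornerPt 2 ∉ e)
  else ∅

/-- The trace `Tr f ⊆ E G_n` of an edge set `f ⊆ E G_{n+1}`. -/
def trace (n : ℕ) (f : Finset (Sym2 Pt)) : Finset (Sym2 Pt) :=
  Finset.univ.biUnion fun w : Fin n → Fin 3 =>
    (traceCell (restrictE w (n + 1) f)).image (Sym2.map (psiWord w))

/-- `Q_n = T_n ∪ S_n^1 ∪ S_n^2 ∪ S_n^3 ∪ R_n`. -/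
def qSet (n : ℕ) : Finset (Finset (Sym2 Pt)) :=
  treeSet n ∪ twoForestSet n 0 ∪ twoForestSet n 1 ∪ twoForestSet n 2 ∪ threeForestSet n

/-! ### Geometry of the cells -/

/-- Barycentric coordinates with respect to the three corners. -/
def bary : Fin 3 → Pt → ℝ
  | 0, x => 1 - x.1 - x.2 / √3
  | 1, x => x.1 - x.2 / √3
  | 2, x => 2 * x.2 / √3

lemma bary_sum (x : Pt) : bary 0 x + bary 1 x + bary 2 x = 1 := by
  simp only [bary]; ring

lemma bary_cornerPt (i j : Fin 3) : bary i (cornerPt j) = if i = j then 1 else 0 := by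
  have h : √3 ≠ 0 := by positivity
  fin_cases i <;> fin_cases j <;> simp [bary, cornerPt] <;> field_simp <;> norm_num

lemma bary_psi (k i : Fin 3) (x : Pt) :
    bary k (psi i x) = (bary k x + bary k (cornerPt i)) / 2 := by
  fin_cases k <;> simp only [bary, psi] <;> ring

lemma eq_of_bary_eq {x y : Pt} (h : ∀ i, bary i x = bary i y) : x = y := by
  have h3 : √3 ≠ 0 := by positivity
  have h2 := h 2
  have h1 := h 1
  simp only [bary] at h1 h2
  have e2 : x.2 = y.2 := by field_simp at h2; linarith
  rw [e2] at h1
  exact Prod.ext (by linarith) e2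

lemma cornerPt_injective : Function.Injective cornerPt := by
  intro i j h
  by_contra hij
  have := bary_cornerPt i j
  rw [← h, bary_cornerPt] at this
  simp [hij] at this

lemma psi_injective (i : Fin 3) : Function.Injective (psi i) := by
  intro x y h
  apply eq_of_bary_eq
  intro k
  have := congrArg (bary k) h
  rw [bary_psi, bary_psi] at this
  linarith

lemma psi_cornerPt_comm (i j : Fin 3) : psi i (cornerPt j) = psi j (cornerPt i) := by
  simp [psi, add_comm]

lemma psi_cornerPt_self (i : Fin 3) : psi i (cornerPt i) = cornerPt i := by
  ext <;> simp [psi]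

lemma mem_sierpV_succ {n : ℕ} {x : Pt} :
    x ∈ sierpV (n + 1) ↔ ∃ i, ∃ y ∈ sierpV n, psi i y = x := by
  simp [sierpV, Fin.exists_fin_succ]

lemma mem_sierpE_succ {n : ℕ} {e : Sym2 Pt} :
    e ∈ sierpE (n + 1) ↔ ∃ i, ∃ e' ∈ sierpE n, Sym2.map (psi i) e' = e := by
  simp [sierpE, Fin.exists_fin_succ]

lemma cornerPt_mem_sierpV (n : ℕ) (i : Fin 3) : cornerPt i ∈ sierpV n := by
  induction n with
  | zero => fin_cases i <;> simp [sierpV]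
  | succ n ih => exact mem_sierpV_succ.2 ⟨i, _, ih, psi_cornerPt_self i⟩

lemma bary_nonneg {n : ℕ} {x : Pt} (hx : x ∈ sierpV n) (k : Fin 3) : 0 ≤ bary k x := by
  induction n generalizing x with
  | zero =>
    simp only [sierpV, Finset.mem_insert, Finset.mem_singleton] at hx
    rcases hx with rfl | rfl | rfl <;> rw [bary_cornerPt] <;> split_ifs <;> norm_num
  | succ n ih =>
    obtain ⟨i, y, hy, rfl⟩ := mem_sierpV_succ.1 hx
    have := ih hy
    rw [bary_psi, bary_cornerPt]
    split_ifs <;> linarith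

/-- Two distinct cells share only the common image of the two corners. -/
lemma eq_cornerPt_of_psi_eq {n : ℕ} {i j : Fin 3} (hij : i ≠ j) {x y : Pt}
    (hx : x ∈ sierpV n) (hy : y ∈ sierpV n) (h : psi i x = psi j y) : x = cornerPt j := by
  have key : ∀ k, bary k x + bary k (cornerPt i) = bary k y + bary k (cornerPt j) := by
    intro k
    have := congrArg (bary k) h
    rw [bary_psi, bary_psi] at this
    linarith
  have hx' := bary_nonneg hx
  have hy' := bary_nonneg hy
  have sx := bary_sum x
  have sy := bary_sum y
  apply eq_of_bary_eq
  have k0 := key 0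
  have k1 := key 1
  have k2 := key 2
  have hx0 := hx' 0
  have hx1 := hx' 1
  have hx2 := hx' 2
  have hy0 := hy' 0
  have hy1 := hy' 1
  have hy2 := hy' 2
  clear key hx' hy' hx hy h
  simp only [bary_cornerPt] at *
  intro k
  fin_cases i <;> fin_cases j <;> fin_cases k <;> simp at * <;> linarith

lemma sierpE_subset {n : ℕ} {x y : Pt} (h : s(x, y) ∈ sierpE n) :
    x ∈ sierpV n ∧ y ∈ sierpV n ∧ x ≠ y := by
  induction n generalizing x y with
  | zero =>
    have c := cornerPt_mem_sierpV 0
    have d : ∀ i j, i ≠ j → cornerPt i ≠ cornerPt j := fun i j h => cornerPt_injective.ne h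
    simp only [sierpE, Finset.mem_insert, Finset.mem_singleton, Sym2.eq_iff] at h
    rcases h with (⟨rfl, rfl⟩ | ⟨rfl, rfl⟩) | (⟨rfl, rfl⟩ | ⟨rfl, rfl⟩) | (⟨rfl, rfl⟩ | ⟨rfl, rfl⟩) <;>
      exact ⟨c _, c _, d _ _ (by decide)⟩
  | succ n ih =>
    obtain ⟨i, e, he, h⟩ := mem_sierpE_succ.1 h
    induction e with
    | _ a b =>
      obtain ⟨ha, hb, hab⟩ := ih he
      have key : ∀ {x y}, psi i a = x → psi i b = y →
          x ∈ sierpV (n + 1) ∧ y ∈ sierpV (n + 1) ∧ x ≠ y := by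
        rintro x y rfl rfl
        exact ⟨mem_sierpV_succ.2 ⟨i, _, ha, rfl⟩, mem_sierpV_succ.2 ⟨i, _, hb, rfl⟩,
          (psi_injective i).ne hab⟩
      rcases Sym2.eq_iff.1 h with ⟨h1, h2⟩ | ⟨h1, h2⟩
      · exact key h1 h2
      · obtain ⟨p, q, r⟩ := key h1 h2
        exact ⟨q, p, r.symm⟩

lemma map_psi_injective (i : Fin 3) : Function.Injective (Sym2.map (psi i)) :=
  Sym2.map.injective (psi_injective i)

/-- Distinct cells are edge-disjoint. -/
lemma eq_of_map_psi_eq {n : ℕ} {i j : Fin 3} {e e' : Sym2 Pt} (he : e ∈ sierpE n)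
    (he' : e' ∈ sierpE n) (h : Sym2.map (psi i) e = Sym2.map (psi j) e') : i = j := by
  by_contra hij
  induction e with
  | _ a b =>
    induction e' with
    | _ c d =>
      obtain ⟨ha, hb, hab⟩ := sierpE_subset he
      obtain ⟨hc, hd, -⟩ := sierpE_subset he'
      apply hab
      rcases Sym2.eq_iff.1 h with ⟨h1, h2⟩ | ⟨h1, h2⟩
      · rw [eq_cornerPt_of_psi_eq hij ha hc h1, eq_cornerPt_of_psi_eq hij hb hd h2]
      · rw [eq_cornerPt_of_psi_eq hij ha hd h1, eq_cornerPt_of_psi_eq hij hb hc h2]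

/-! ### Reachability in edge sets -/

lemma graphOf_adj {F : Finset (Sym2 Pt)} {x y : Pt} :
    (graphOf F).Adj x y ↔ s(x, y) ∈ F ∧ x ≠ y := by
  simp [graphOf]

lemma graphOf_mono {F F' : Finset (Sym2 Pt)} (h : F ⊆ F') : graphOf F ≤ graphOf F' :=
  SimpleGraph.fromEdgeSet_mono (by exact_mod_cast h)

lemma reachable_of_mem {F : Finset (Sym2 Pt)} {x y : Pt} (h : s(x, y) ∈ F) :
    (graphOf F).Reachable x y := by
  by_cases hxy : x = y
  · rw [hxy]
  · exact (graphOf_adj.2 ⟨h, hxy⟩).reachable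

lemma reachable_induction {F : Finset (Sym2 Pt)} {x y : Pt} (h : (graphOf F).Reachable x y)
    (p : Pt → Prop) (h0 : p x) (hs : ∀ y z, s(y, z) ∈ F → p y → p z) : p y := by
  rw [SimpleGraph.reachable_iff_reflTransGen] at h
  induction h with
  | refl => exact h0
  | tail _ h ih => exact hs _ _ (graphOf_adj.1 h).1 ih

/-- A similitude of the family transports reachability. -/
lemma reachable_psi {F F' : Finset (Sym2 Pt)} (i : Fin 3)
    (hF : ∀ e ∈ F, Sym2.map (psi i) e ∈ F') {x y : Pt} (h : (graphOf F).Reachable x y) :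
    (graphOf F').Reachable (psi i x) (psi i y) :=
  reachable_induction h (fun y => (graphOf F').Reachable (psi i x) (psi i y)) (.refl _)
    fun y z hyz hy => hy.trans (reachable_of_mem (hF s(y, z) hyz))

lemma isAcyclic_graphOf_iff {F : Finset (Sym2 Pt)} (hF : ∀ x y, s(x, y) ∈ F → x ≠ y) :
    (graphOf F).IsAcyclic ↔
      ∀ x y, s(x, y) ∈ F → ¬ (graphOf (F.erase s(x, y))).Reachable x y := by
  rw [SimpleGraph.isAcyclic_iff_forall_adj_isBridge]
  have key : ∀ x y, (graphOf F).deleteEdges {s(x, y)} = graphOf (F.erase s(x, y)) := by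
    intro x y
    ext a b
    simp only [SimpleGraph.deleteEdges_adj, graphOf_adj, Finset.mem_erase, Set.mem_singleton_iff]
    tauto
  simp only [SimpleGraph.isBridge_iff, key, graphOf_adj]
  exact ⟨fun h x y hxy => h ⟨hxy, hF x y hxy⟩, fun h x y hxy => h x y hxy.1⟩

/-- In a forest, two points joined through two edge-disjoint subgraphs coincide. -/
lemma eq_of_reachable_disjoint {F A B : Finset (Sym2 Pt)} (hF : (graphOf F).IsAcyclic)
    (hA : A ⊆ F) (hB : B ⊆ F) (hAB : ∀ e ∈ A, e ∉ B) {x y : Pt}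
    (h1 : (graphOf A).Reachable x y) (h2 : (graphOf B).Reachable x y) : x = y := by
  obtain ⟨p, hp⟩ := h1.exists_isPath
  obtain ⟨q, hq⟩ := h2.exists_isPath
  have h := (hF.subsingleton_path x y).elim ⟨p.mapLe (graphOf_mono hA), hp.mapLe _⟩
    ⟨q.mapLe (graphOf_mono hB), hq.mapLe _⟩
  have he : p.edges = q.edges := by
    simpa using congrArg (fun r => SimpleGraph.Walk.edges r.1) h
  cases p with
  | nil => rfl
  | @cons _ v _ hadj p' =>
    exfalso
    have hm : s(x, v) ∈ q.edges := by rw [← he]; simp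
    exact hAB _ (graphOf_adj.1 hadj).1
      (graphOf_adj.1 (q.adj_of_mem_edges hm)).1

/-! ### Gluing three cells -/

/-- The restriction of an edge set of `G_{n+1}` to its cell `i`, as an edge set of `G_n`. -/
def cellE (n : ℕ) (i : Fin 3) (F : Finset (Sym2 Pt)) : Finset (Sym2 Pt) :=
  (sierpE n).filter fun e => Sym2.map (psi i) e ∈ F

lemma mem_cellE {n : ℕ} {i : Fin 3} {F : Finset (Sym2 Pt)} {e : Sym2 Pt} :
    e ∈ cellE n i F ↔ e ∈ sierpE n ∧ Sym2.map (psi i) e ∈ F := by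
  simp [cellE]

/-- The connection pattern of an edge set on the three corners. -/
def part (F : Finset (Sym2 Pt)) (j k : Fin 3) : Prop :=
  (graphOf F).Reachable (cornerPt j) (cornerPt k)

lemma part_refl (F : Finset (Sym2 Pt)) (j : Fin 3) : part F j j := .refl _

lemma part.symm {F : Finset (Sym2 Pt)} {j k : Fin 3} (h : part F j k) : part F k j :=
  SimpleGraph.Reachable.symm h

lemma part.trans {F : Finset (Sym2 Pt)} {i j k : Fin 3} (h : part F i j) (h' : part F j k) :
    part F i k :=
  SimpleGraph.Reachable.trans h h'

/-- If `P i` is the connection pattern of cell `i`, then `Conn P a b i c` says that corner `b`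
of cell `a` is connected to corner `c` of cell `i`, inside one cell, directly from
cell `a` to cell `i`, or around the central triangle. -/
def Conn (P : Fin 3 → Fin 3 → Fin 3 → Prop) (a b i c : Fin 3) : Prop :=
  (i = a ∧ (P a b c ∨ ∃ j k, j ≠ a ∧ k ≠ a ∧ j ≠ k ∧ P a b j ∧ P j a k ∧ P k j a ∧ P a k c)) ∨
  (i ≠ a ∧ ((P a b i ∧ P i a c) ∨ ∃ k, k ≠ a ∧ k ≠ i ∧ P a b k ∧ P k a i ∧ P i k c))

/-- The three cells connect up all around the central triangle. -/
def ClosedRing (P : Fin 3 → Fin 3 → Fin 3 → Prop) : Prop :=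
  ∀ a j k, j ≠ a → k ≠ a → P a j k

lemma fin_three_cases {i j k : Fin 3} (hij : i ≠ j) (hik : i ≠ k) (hjk : j ≠ k) (x : Fin 3) :
    x = i ∨ x = j ∨ x = k := by
  omega

lemma Conn.step {P : Fin 3 → Fin 3 → Fin 3 → Prop} (hP : ∀ i j, P i j j) {a b i j c : Fin 3}
    (hij : i ≠ j) (h : Conn P a b j c)
    (ht : ∀ {a i j k}, P a i j → P a j k → P a i k)
    (hc : P j c i) : Conn P a b i j := by
  rcases h with ⟨rfl, h1 | ⟨j', k', hj, hk, hjk, h1, h2, h3, h4⟩⟩ |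
    ⟨hja, ⟨h1, h2⟩ | ⟨k, hk, hki, h1, h2, h3⟩⟩
  · exact .inr ⟨hij, .inl ⟨ht h1 hc, hP _ _⟩⟩
  · rcases fin_three_cases hj.symm hk.symm hjk i with rfl | rfl | rfl
    · exact absurd rfl hij
    · exact .inr ⟨hij, .inl ⟨h1, hP _ _⟩⟩
    · exact .inr ⟨hij, .inr ⟨j', hj, hjk, h1, h2, h3⟩⟩
  · by_cases hia : i = a
    · subst hia
      exact .inl ⟨rfl, .inl h1⟩
    · exact .inr ⟨hia, .inr ⟨j, hja, hij.symm, h1, ht h2 hc, hP _ _⟩⟩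
  · rcases fin_three_cases hja.symm hk.symm hki.symm i with rfl | rfl | rfl
    · exact .inl ⟨rfl, .inr ⟨k, j, hk, hja, hki, h1, h2, ht h3 hc, hP _ _⟩⟩
    · exact absurd rfl hij
    · exact .inr ⟨hk, .inl ⟨h1, h2⟩⟩

lemma cellE_subset (n : ℕ) (i : Fin 3) (F : Finset (Sym2 Pt)) : cellE n i F ⊆ sierpE n :=
  Finset.filter_subset _ _

lemma reachable_of_cellE {n : ℕ} {i : Fin 3} {F : Finset (Sym2 Pt)} {x y : Pt}
    (h : (graphOf (cellE n i F)).Reachable x y) :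
    (graphOf F).Reachable (psi i x) (psi i y) :=
  reachable_psi i (fun _ he => (mem_cellE.1 he).2) h

lemma reachable_of_conn {n : ℕ} {F : Finset (Sym2 Pt)} {a b i c : Fin 3}
    (h : Conn (fun i => part (cellE n i F)) a b i c) :
    (graphOf F).Reachable (psi a (cornerPt b)) (psi i (cornerPt c)) := by
  have key : ∀ {i j k}, part (cellE n i F) j k →
      (graphOf F).Reachable (psi i (cornerPt j)) (psi i (cornerPt k)) := reachable_of_cellE
  have sw := psi_cornerPt_comm
  rcases h with ⟨rfl, h1 | ⟨j, k, hj, hk, hjk, h1, h2, h3, h4⟩⟩ |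
    ⟨hi, ⟨h1, h2⟩ | ⟨k, hk, hki, h1, h2, h3⟩⟩
  · exact key h1
  · have h1 := key h1
    have h2 := key h2
    have h4 := key h4
    rw [sw i j] at h1
    rw [sw j k] at h2
    rw [sw i k] at h4
    exact h1.trans (h2.trans ((key h3).trans h4))
  · have h1 := key h1
    rw [sw a i] at h1
    exact h1.trans (key h2)
  · have h1 := key h1
    have h2 := key h2
    rw [sw a k] at h1
    rw [sw k i] at h2
    exact h1.trans (h2.trans (key h3))

/-- Reachability in a union of three cells, in terms of reachability in the cells. -/
lemma cellE_reachable {n : ℕ} {F : Finset (Sym2 Pt)} (hF : F ⊆ sierpE (n + 1)) {a : Fin 3}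
    {v y : Pt} (hv : v ∈ sierpV n) (h : (graphOf F).Reachable (psi a v) y) :
    ∀ i, ∀ x ∈ sierpV n, psi i x = y →
      (i = a ∧ (graphOf (cellE n a F)).Reachable v x) ∨
      ∃ b c, (graphOf (cellE n a F)).Reachable v (cornerPt b) ∧
        Conn (fun i => part (cellE n i F)) a b i c ∧
        (graphOf (cellE n i F)).Reachable (cornerPt c) x := by
  refine reachable_induction h (fun y => ∀ i, ∀ x ∈ sierpV n, psi i x = y →
      (i = a ∧ (graphOf (cellE n a F)).Reachable v x) ∨
      ∃ b c, (graphOf (cellE n a F)).Reachable v (cornerPt b) ∧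
        Conn (fun i => part (cellE n i F)) a b i c ∧
        (graphOf (cellE n i F)).Reachable (cornerPt c) x) ?_ ?_
  · intro i x hx hxv
    by_cases hia : i = a
    · subst hia
      rw [psi_injective i hxv]
      exact .inl ⟨rfl, .refl _⟩
    · have h1 := eq_cornerPt_of_psi_eq hia hx hv hxv
      have h2 := eq_cornerPt_of_psi_eq (Ne.symm hia) hv hx hxv.symm
      subst h1 h2
      exact .inr ⟨i, a, .refl _, .inr ⟨hia, .inl ⟨part_refl _ _, part_refl _ _⟩⟩, .refl _⟩
  · intro y z hyz ih i x hx hxz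
    obtain ⟨j, e, he, hmap⟩ := mem_sierpE_succ.1 (hF hyz)
    obtain ⟨y', z', hadj, rfl, rfl⟩ : ∃ y' z', s(y', z') ∈ sierpE n ∧ psi j y' = y ∧
        psi j z' = z := by
      induction e with
      | _ p q =>
        rcases Sym2.eq_iff.1 hmap with ⟨h1, h2⟩ | ⟨h1, h2⟩
        · exact ⟨p, q, he, h1, h2⟩
        · exact ⟨q, p, by rwa [Sym2.eq_swap], h2, h1⟩
    have hcell : (graphOf (cellE n j F)).Reachable y' z' :=
      reachable_of_mem (mem_cellE.2 ⟨hadj, hyz⟩)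
    obtain ⟨hy', hz', -⟩ := sierpE_subset hadj
    have hz : (j = a ∧ (graphOf (cellE n a F)).Reachable v z') ∨
      ∃ b c, (graphOf (cellE n a F)).Reachable v (cornerPt b) ∧
        Conn (fun i => part (cellE n i F)) a b j c ∧
        (graphOf (cellE n j F)).Reachable (cornerPt c) z' := by
      rcases ih j y' hy' rfl with ⟨rfl, h⟩ | ⟨b, c, h1, h2, h3⟩
      · exact .inl ⟨rfl, h.trans hcell⟩
      · exact .inr ⟨b, c, h1, h2, h3.trans hcell⟩
    by_cases hij : i = j
    · subst hij
      rwa [psi_injective i hxz]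
    · have h1 := eq_cornerPt_of_psi_eq hij hx hz' hxz
      have h2 := eq_cornerPt_of_psi_eq (Ne.symm hij) hz' hx hxz.symm
      subst h1 h2
      right
      rcases hz with ⟨rfl, h⟩ | ⟨b, c, h1, h2, h3⟩
      · exact ⟨i, j, h, .inr ⟨hij, .inl ⟨part_refl _ _, part_refl _ _⟩⟩, .refl _⟩
      · exact ⟨b, j, h1, h2.step (fun _ _ => part_refl _ _) hij part.trans h3, .refl _⟩

lemma Conn.extend {P : Fin 3 → Fin 3 → Fin 3 → Prop}
    (ht : ∀ {a i j k}, P a i j → P a j k → P a i k) {a b b' i c c' : Fin 3}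
    (hb : P a b' b) (h : Conn P a b i c) (hc : P i c c') : Conn P a b' i c' := by
  rcases h with ⟨rfl, h1 | ⟨j, k, hj, hk, hjk, h1, h2, h3, h4⟩⟩ |
    ⟨hi, ⟨h1, h2⟩ | ⟨k, hk, hki, h1, h2, h3⟩⟩
  · exact .inl ⟨rfl, .inl (ht hb (ht h1 hc))⟩
  · exact .inl ⟨rfl, .inr ⟨j, k, hj, hk, hjk, ht hb h1, h2, h3, ht h4 hc⟩⟩
  · exact .inr ⟨hi, .inl ⟨ht hb h1, ht h2 hc⟩⟩
  · exact .inr ⟨hi, .inr ⟨k, hk, hki, ht hb h1, h2, ht h3 hc⟩⟩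

/-- Connections between the corners of cells are determined by the connection patterns. -/
lemma reachable_psi_cornerPt_iff {n : ℕ} {F : Finset (Sym2 Pt)} (hF : F ⊆ sierpE (n + 1))
    {a b i c : Fin 3} :
    (graphOf F).Reachable (psi a (cornerPt b)) (psi i (cornerPt c)) ↔
      Conn (fun i => part (cellE n i F)) a b i c := by
  refine ⟨fun h => ?_, reachable_of_conn⟩
  rcases cellE_reachable hF (cornerPt_mem_sierpV n b) h i _ (cornerPt_mem_sierpV n c) rfl with
    ⟨rfl, h⟩ | ⟨b', c', h1, h2, h3⟩
  · exact .inl ⟨rfl, .inl h⟩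
  · exact h2.extend (P := fun i => part (cellE n i F)) part.trans h1 h3

lemma part_iff_conn {n : ℕ} {F : Finset (Sym2 Pt)} (hF : F ⊆ sierpE (n + 1)) {j k : Fin 3} :
    part F j k ↔ Conn (fun i => part (cellE n i F)) j j k k := by
  rw [← reachable_psi_cornerPt_iff hF, psi_cornerPt_self, psi_cornerPt_self, part]

/-- A spanning forest of `G_n` each of whose components contains a corner. -/
structure IsCornerForest (n : ℕ) (F : Finset (Sym2 Pt)) : Prop where
  subset : F ⊆ sierpE n
  acyclic : (graphOf F).IsAcyclic
  covered : ∀ x ∈ sierpV n, ∃ j, (graphOf F).Reachable (cornerPt j) x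

lemma ne_of_mem_of_subset {n : ℕ} {F : Finset (Sym2 Pt)} (hF : F ⊆ sierpE n) :
    ∀ x y, s(x, y) ∈ F → x ≠ y :=
  fun _ _ h => (sierpE_subset (hF h)).2.2

lemma not_ring_of_isAcyclic {n : ℕ} {F : Finset (Sym2 Pt)} (h : (graphOf F).IsAcyclic) :
    ¬ ClosedRing fun i => part (cellE n i F) := by
  intro hr
  let A := F.filter (· ∈ psiCellE 0 n)
  let B := F.filter (· ∉ psiCellE 0 n)
  have h1 : (graphOf A).Reachable (psi 0 (cornerPt 1)) (psi 0 (cornerPt 2)) := by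
    refine reachable_psi 0 ?_ (hr 0 1 2 (by decide) (by decide))
    intro e he
    obtain ⟨he, heF⟩ := mem_cellE.1 he
    exact Finset.mem_filter.2 ⟨heF, Finset.mem_image_of_mem _ he⟩
  have key : ∀ i : Fin 3, i ≠ 0 → ∀ x y, (graphOf (cellE n i F)).Reachable x y →
      (graphOf B).Reachable (psi i x) (psi i y) := by
    intro i hi x y hxy
    refine reachable_psi i ?_ hxy
    intro e he
    obtain ⟨he, heF⟩ := mem_cellE.1 he
    refine Finset.mem_filter.2 ⟨heF, fun hm => hi ?_⟩
    obtain ⟨e', he', hee'⟩ := Finset.mem_image.1 hm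
    exact (eq_of_map_psi_eq he' he hee').symm
  have h2 : (graphOf B).Reachable (psi 0 (cornerPt 1)) (psi 0 (cornerPt 2)) := by
    have p := key 1 (by decide) _ _ (hr 1 0 2 (by decide) (by decide))
    have q := key 2 (by decide) _ _ (hr 2 1 0 (by decide) (by decide))
    rw [psi_cornerPt_comm 1 0, psi_cornerPt_comm 1 2] at p
    rw [psi_cornerPt_comm 2 0] at q
    exact p.trans q
  have := eq_of_reachable_disjoint h (Finset.filter_subset _ _) (Finset.filter_subset _ _)
    (fun e (he : e ∈ A) (he' : e ∈ B) =>
      (Finset.mem_filter.1 he').2 (Finset.mem_filter.1 he).2) h1 h2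
  exact absurd (cornerPt_injective (psi_injective 0 this)) (by decide)

lemma isAcyclic_cellE {n : ℕ} {F : Finset (Sym2 Pt)} (h : (graphOf F).IsAcyclic) (i : Fin 3) :
    (graphOf (cellE n i F)).IsAcyclic := by
  refine h.comap ⟨psi i, fun {x y} hxy => ?_⟩ (psi_injective i)
  obtain ⟨h1, h2⟩ := graphOf_adj.1 hxy
  exact graphOf_adj.2 ⟨(mem_cellE.1 h1).2, (psi_injective i).ne h2⟩

lemma ring_of_cycle {P : Fin 3 → Fin 3 → Fin 3 → Prop} (hr : ∀ i j, P i j j)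
    (hs : ∀ {i j k}, P i j k → P i k j) {a j k : Fin 3} (hj : j ≠ a) (hk : k ≠ a) (hjk : j ≠ k)
    (h1 : P a j k) (h2 : P j a k) (h3 : P k j a) : ClosedRing P := by
  intro x y z hy hz
  have h1' := hs h1
  have h2' := hs h2
  have h3' := hs h3
  have c := fin_three_cases hj.symm hk.symm hjk
  rcases c x with rfl | rfl | rfl <;> rcases c y with rfl | rfl | rfl <;>
    rcases c z with rfl | rfl | rfl <;> first | contradiction | exact hr _ _ | assumption

lemma isAcyclic_of_cellE {n : ℕ} {F : Finset (Sym2 Pt)} (hF : F ⊆ sierpE (n + 1))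
    (h : ∀ i, (graphOf (cellE n i F)).IsAcyclic) (hr : ¬ ClosedRing fun i => part (cellE n i F)) :
    (graphOf F).IsAcyclic := by
  rw [isAcyclic_graphOf_iff (ne_of_mem_of_subset hF)]
  intro x y hxy hreach
  obtain ⟨a, e, he, hmap⟩ := mem_sierpE_succ.1 (hF hxy)
  obtain ⟨v, w, hvw, rfl, rfl⟩ : ∃ v w, s(v, w) ∈ sierpE n ∧ psi a v = x ∧ psi a w = y := by
    induction e with
    | _ p q =>
      rcases Sym2.eq_iff.1 hmap with ⟨h1, h2⟩ | ⟨h1, h2⟩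
      · exact ⟨p, q, he, h1, h2⟩
      · exact ⟨q, p, by rwa [Sym2.eq_swap], h2, h1⟩
  obtain ⟨hv, hw, -⟩ := sierpE_subset hvw
  set F' := F.erase s(psi a v, psi a w) with hF'
  have hsub : F' ⊆ F := Finset.erase_subset _ _
  have hcs : ∀ i, cellE n i F' ⊆ cellE n i F := fun i e he =>
    mem_cellE.2 ⟨(mem_cellE.1 he).1, hsub (mem_cellE.1 he).2⟩
  have hmono : ∀ i x y, (graphOf (cellE n i F')).Reachable x y →
      (graphOf (cellE n i F)).Reachable x y := fun i x y h => h.mono (graphOf_mono (hcs i))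
  have hcell : (graphOf (cellE n a F)).Reachable v w :=
    reachable_of_mem (mem_cellE.2 ⟨hvw, hxy⟩)
  have hno : ¬ (graphOf (cellE n a F')).Reachable v w := by
    have := (isAcyclic_graphOf_iff (ne_of_mem_of_subset (cellE_subset n a F))).1 (h a) v w
      (mem_cellE.2 ⟨hvw, hxy⟩)
    refine fun h => this (h.mono (graphOf_mono fun e he => ?_))
    refine Finset.mem_erase.2 ⟨?_, hcs a he⟩
    rintro rfl
    exact Finset.notMem_erase _ _ (mem_cellE.1 he).2
  rcases cellE_reachable (hsub.trans hF) hv hreach a w hw rfl with ⟨-, h'⟩ | ⟨b, c, h1, h2, h3⟩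
  · exact hno h'
  · rcases h2 with ⟨-, h4 | ⟨j, k, hj, hk, hjk, h4, h5, h6, h7⟩⟩ | ⟨h4, -⟩
    · exact hno (h1.trans (SimpleGraph.Reachable.trans h4 h3))
    · refine hr (ring_of_cycle (P := fun i => part (cellE n i F)) (fun _ _ => part_refl _ _)
        part.symm hj hk hjk ?_
        (hmono _ _ _ h5) (hmono _ _ _ h6))
      have hvj := hmono _ _ _ (h1.trans h4)
      have hkw := hmono _ _ _ (SimpleGraph.Reachable.trans h7 h3)
      exact hvj.symm.trans (hcell.trans hkw.symm)
    · exact h4 rfl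

/-- The gluing principle: corner forests of `G_{n+1}` are the edge sets whose cells are corner
forests with suitable connection patterns. -/
lemma isCornerForest_succ_iff {n : ℕ} {F : Finset (Sym2 Pt)} (hF : F ⊆ sierpE (n + 1)) :
    IsCornerForest (n + 1) F ↔ (∀ i, IsCornerForest n (cellE n i F)) ∧
      (¬ ClosedRing fun i => part (cellE n i F)) ∧
      ∀ a b, ∃ j, Conn (fun i => part (cellE n i F)) j j a b := by
  constructor
  · intro h
    refine ⟨fun i => ⟨cellE_subset n i F, isAcyclic_cellE h.acyclic i, fun x hx => ?_⟩,
      not_ring_of_isAcyclic h.acyclic, fun a b => ?_⟩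
    · obtain ⟨j, hj⟩ := h.covered _ (mem_sierpV_succ.2 ⟨i, x, hx, rfl⟩)
      rw [← psi_cornerPt_self j] at hj
      rcases cellE_reachable hF (cornerPt_mem_sierpV n j) hj i x hx rfl with
        ⟨rfl, h⟩ | ⟨b, c, h1, h2, h3⟩
      · exact ⟨_, h⟩
      · exact ⟨_, h3⟩
    · obtain ⟨j, hj⟩ := h.covered _ (mem_sierpV_succ.2 ⟨a, _, cornerPt_mem_sierpV n b, rfl⟩)
      rw [← psi_cornerPt_self j] at hj
      exact ⟨j, (reachable_psi_cornerPt_iff hF).1 hj⟩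
  · rintro ⟨h1, h2, h3⟩
    refine ⟨hF, isAcyclic_of_cellE hF (fun i => (h1 i).acyclic) h2, fun x hx => ?_⟩
    obtain ⟨i, y, hy, rfl⟩ := mem_sierpV_succ.1 hx
    obtain ⟨c, hc⟩ := (h1 i).covered y hy
    obtain ⟨j, hj⟩ := h3 i c
    have := (reachable_psi_cornerPt_iff hF).2 hj
    rw [psi_cornerPt_self] at this
    exact ⟨j, this.trans (reachable_of_cellE hc)⟩

lemma mem_treeSet_iff {n : ℕ} {F : Finset (Sym2 Pt)} :
    F ∈ treeSet n ↔ IsCornerForest n F ∧ ∀ j k, part F j k := by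
  simp only [treeSet, Finset.mem_filter, Finset.mem_powerset]
  have c := cornerPt_mem_sierpV n
  constructor
  · rintro ⟨h1, h2, h3⟩
    exact ⟨⟨h1, h2, fun x hx => ⟨0, h3 _ (c 0) _ hx⟩⟩, fun j k => h3 _ (c j) _ (c k)⟩
  · rintro ⟨⟨h1, h2, h3⟩, h4⟩
    refine ⟨h1, h2, fun x hx y hy => ?_⟩
    obtain ⟨j, hj⟩ := h3 x hx
    obtain ⟨k, hk⟩ := h3 y hy
    exact hj.symm.trans (SimpleGraph.Reachable.trans (h4 j k) hk)

lemma mem_twoForestSet_iff {n : ℕ} {i : Fin 3} {F : Finset (Sym2 Pt)} :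
    F ∈ twoForestSet n i ↔ IsCornerForest n F ∧ (∀ j, j ≠ i → ¬ part F i j) ∧
      ∀ j k, j ≠ i → k ≠ i → part F j k := by
  simp only [twoForestSet, Finset.mem_filter, Finset.mem_powerset]
  exact ⟨fun ⟨h1, h2, h3, h4, h5⟩ => ⟨⟨h1, h2, h5⟩, h3, h4⟩,
    fun ⟨⟨h1, h2, h5⟩, h3, h4⟩ => ⟨h1, h2, h3, h4, h5⟩⟩

lemma mem_threeForestSet_iff {n : ℕ} {F : Finset (Sym2 Pt)} :
    F ∈ threeForestSet n ↔ IsCornerForest n F ∧ ∀ j k, j ≠ k → ¬ part F j k := by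
  simp only [threeForestSet, Finset.mem_filter, Finset.mem_powerset]
  exact ⟨fun ⟨h1, h2, h3, h5⟩ => ⟨⟨h1, h2, h5⟩, h3⟩, fun ⟨⟨h1, h2, h5⟩, h3⟩ => ⟨h1, h2, h3, h5⟩⟩

lemma IsCornerForest.cases {n : ℕ} {F : Finset (Sym2 Pt)} (h : IsCornerForest n F) :
    F ∈ treeSet n ∨ (∃ i, F ∈ twoForestSet n i) ∨ F ∈ threeForestSet n := by
  by_cases h0 : ∃ i j k, i ≠ j ∧ i ≠ k ∧ j ≠ k ∧ part F j k
  · obtain ⟨i, j, k, hij, hik, hjk, hp⟩ := h0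
    have c := fin_three_cases hij hik hjk
    by_cases hi : part F i j
    · left
      refine mem_treeSet_iff.2 ⟨h, fun x y => ?_⟩
      have key : ∀ x, part F j x := by
        intro x
        rcases c x with rfl | rfl | rfl
        exacts [hi.symm, part_refl _ _, hp]
      exact (key x).symm.trans (key y)
    · refine .inr (.inl ⟨i, mem_twoForestSet_iff.2 ⟨h, fun x hx hix => ?_, fun x y hx hy => ?_⟩⟩)
      · rcases c x with rfl | rfl | rfl
        exacts [hx rfl, hi hix, hi (hix.trans hp.symm)]
      · have key : ∀ x, x ≠ i → part F j x := by
          intro x hx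
          rcases c x with rfl | rfl | rfl
          exacts [absurd rfl hx, part_refl _ _, hp]
        exact (key x hx).symm.trans (key y hy)
  · refine .inr (.inr (mem_threeForestSet_iff.2 ⟨h, fun j k hjk hp => h0 ?_⟩))
    obtain ⟨i, h1, h2⟩ : ∃ i, i ≠ j ∧ i ≠ k := by
      clear hp
      revert j k
      decide
    exact ⟨i, j, k, h1, h2, hjk, hp⟩

lemma mem_qSet_iff {n : ℕ} {F : Finset (Sym2 Pt)} : F ∈ qSet n ↔ IsCornerForest n F := by
  simp only [qSet, Finset.mem_union]
  constructor
  · rintro ((((h | h) | h) | h) | h)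
    exacts [(mem_treeSet_iff.1 h).1, (mem_twoForestSet_iff.1 h).1, (mem_twoForestSet_iff.1 h).1,
      (mem_twoForestSet_iff.1 h).1, (mem_threeForestSet_iff.1 h).1]
  · intro h
    rcases h.cases with h | ⟨i, h⟩ | h
    · exact .inl (.inl (.inl (.inl h)))
    · fin_cases i
      exacts [.inl (.inl (.inl (.inr h))), .inl (.inl (.inr h)), .inl (.inr h)]
    · exact .inr h

lemma part_iff_of_mem_treeSet {n m : ℕ} {F F' : Finset (Sym2 Pt)} (h : F ∈ treeSet n)
    (h' : F' ∈ treeSet m) (j k : Fin 3) : part F j k ↔ part F' j k :=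
  iff_of_true ((mem_treeSet_iff.1 h).2 j k) ((mem_treeSet_iff.1 h').2 j k)

lemma part_iff_of_mem_twoForestSet {n m : ℕ} {i : Fin 3} {F F' : Finset (Sym2 Pt)}
    (h : F ∈ twoForestSet n i) (h' : F' ∈ twoForestSet m i) (j k : Fin 3) :
    part F j k ↔ part F' j k := by
  obtain ⟨-, h1, h2⟩ := mem_twoForestSet_iff.1 h
  obtain ⟨-, h1', h2'⟩ := mem_twoForestSet_iff.1 h'
  by_cases hjk : j = k
  · subst hjk
    exact iff_of_true (part_refl _ _) (part_refl _ _)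
  by_cases hj : j = i
  · subst hj
    exact iff_of_false (h1 _ (Ne.symm hjk)) (h1' _ (Ne.symm hjk))
  by_cases hk : k = i
  · subst hk
    exact iff_of_false (fun h => h1 _ hj h.symm) (fun h => h1' _ hj h.symm)
  · exact iff_of_true (h2 _ _ hj hk) (h2' _ _ hj hk)

lemma part_iff_of_mem_threeForestSet {n m : ℕ} {F F' : Finset (Sym2 Pt)}
    (h : F ∈ threeForestSet n) (h' : F' ∈ threeForestSet m) (j k : Fin 3) :
    part F j k ↔ part F' j k := by
  by_cases hjk : j = k
  · subst hjk
    exact iff_of_true (part_refl _ _) (part_refl _ _)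
  · exact iff_of_false ((mem_threeForestSet_iff.1 h).2 _ _ hjk)
      ((mem_threeForestSet_iff.1 h').2 _ _ hjk)

/-- The union of three edge sets of `G_n`, placed in the three cells of `G_{n+1}`. -/
def glueE (f : Fin 3 → Finset (Sym2 Pt)) : Finset (Sym2 Pt) :=
  Finset.univ.biUnion fun i => (f i).image (Sym2.map (psi i))

lemma mem_glueE {f : Fin 3 → Finset (Sym2 Pt)} {e : Sym2 Pt} :
    e ∈ glueE f ↔ ∃ i, ∃ e' ∈ f i, Sym2.map (psi i) e' = e := by
  simp [glueE]

lemma glueE_subset {n : ℕ} {f : Fin 3 → Finset (Sym2 Pt)} (hf : ∀ i, f i ⊆ sierpE n) :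
    glueE f ⊆ sierpE (n + 1) := by
  intro e he
  obtain ⟨i, e', he', h⟩ := mem_glueE.1 he
  exact mem_sierpE_succ.2 ⟨i, e', hf i he', h⟩

lemma cellE_glueE {n : ℕ} {f : Fin 3 → Finset (Sym2 Pt)} (hf : ∀ i, f i ⊆ sierpE n) (i : Fin 3) :
    cellE n i (glueE f) = f i := by
  ext e
  rw [mem_cellE, mem_glueE]
  constructor
  · rintro ⟨he, j, e', he', h⟩
    obtain rfl := eq_of_map_psi_eq (hf j he') he h
    rwa [← map_psi_injective _ h]
  · exact fun he => ⟨hf i he, i, e, he, rfl⟩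

lemma glueE_cellE {n : ℕ} {F : Finset (Sym2 Pt)} (hF : F ⊆ sierpE (n + 1)) :
    glueE (fun i => cellE n i F) = F := by
  ext e
  rw [mem_glueE]
  constructor
  · rintro ⟨i, e', he', rfl⟩
    exact (mem_cellE.1 he').2
  · intro he
    obtain ⟨i, e', he', rfl⟩ := mem_sierpE_succ.1 (hF he)
    exact ⟨i, e', mem_cellE.2 ⟨he', he⟩, rfl⟩

lemma isCornerForest_glueE_iff {n : ℕ} {f : Fin 3 → Finset (Sym2 Pt)}
    (hf : ∀ i, IsCornerForest n (f i)) :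
    IsCornerForest (n + 1) (glueE f) ↔ (¬ ClosedRing fun i => part (f i)) ∧
      ∀ a b, ∃ j, Conn (fun i => part (f i)) j j a b := by
  rw [isCornerForest_succ_iff (glueE_subset fun i => (hf i).subset)]
  simp only [cellE_glueE fun i => (hf i).subset]
  exact and_iff_right hf

lemma part_glueE_iff {n : ℕ} {f : Fin 3 → Finset (Sym2 Pt)} (hf : ∀ i, IsCornerForest n (f i))
    {j k : Fin 3} : part (glueE f) j k ↔ Conn (fun i => part (f i)) j j k k := by
  rw [part_iff_conn (glueE_subset fun i => (hf i).subset)]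
  simp only [cellE_glueE fun i => (hf i).subset]

/-! ### The classes of spanning trees -/

lemma conn_corner_iff {P : Fin 3 → Fin 3 → Fin 3 → Prop} {i j k : Fin 3} (hij : i ≠ j)
    (hik : i ≠ k) (hjk : j ≠ k) :
    Conn P i i j j ↔ (P i i j ∧ P j i j) ∨ (P i i k ∧ P k i j ∧ P j k j) := by
  constructor
  · rintro (⟨h, -⟩ | ⟨-, h | ⟨l, hl, hlj, h⟩⟩)
    · exact absurd h.symm hij
    · exact .inl h
    · rcases fin_three_cases hij hik hjk l with rfl | rfl | rfl
      exacts [absurd rfl hl, absurd rfl hlj, .inr h]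
  · rintro (h | h)
    · exact .inr ⟨hij.symm, .inl h⟩
    · exact .inr ⟨hij.symm, .inr ⟨k, hik.symm, hjk.symm, h⟩⟩

lemma exists_third (i j : Fin 3) : ∃ k, i ≠ k ∧ j ≠ k := by
  revert i j
  decide

/-- A spanning tree of `G_{n+1}` lies in the class `i` iff within cells `i` and `j` it joins
the corners `i` and `j` to their common vertex, for every `j ≠ i`. -/
lemma mem_treeClass_succ_iff {n : ℕ} {i : Fin 3} {F : Finset (Sym2 Pt)} :
    F ∈ treeClass (n + 1) i ↔ F ∈ treeSet (n + 1) ∧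
      ∀ j, j ≠ i → part (cellE n i F) i j ∧ part (cellE n j F) i j := by
  simp only [treeClass, Finset.mem_filter, and_congr_right_iff]
  intro hT
  obtain ⟨hQ, hp⟩ := mem_treeSet_iff.1 hT
  refine forall₂_congr fun j hj => ?_
  set F' := F.filter (· ∈ psiCellE i n ∪ psiCellE j n) with hF'
  have hsub : F' ⊆ F := Finset.filter_subset _ _
  constructor
  · intro h
    obtain ⟨p, hpath⟩ := SimpleGraph.Reachable.exists_isPath (hp i j)
    have hreach : part F' i j := by
      refine ⟨p.transfer (graphOf F') fun e he => ?_⟩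
      induction e with
      | _ x y =>
        have hadj := graphOf_adj.1 (p.adj_of_mem_edges he)
        exact graphOf_adj.2 ⟨Finset.mem_filter.2 ⟨hadj.1, h p hpath _ he⟩, hadj.2⟩
    obtain ⟨k, hik, hjk⟩ := exists_third i j
    rw [part_iff_conn (hsub.trans hQ.subset), conn_corner_iff hj.symm hik hjk] at hreach
    have hmono : ∀ a b c, part (cellE n a F') b c → part (cellE n a F) b c := fun a b c h =>
      SimpleGraph.Reachable.mono (graphOf_mono fun e he =>
        mem_cellE.2 ⟨(mem_cellE.1 he).1, hsub (mem_cellE.1 he).2⟩) h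
    rcases hreach with ⟨h1, h2⟩ | ⟨-, h2, -⟩
    · exact ⟨hmono _ _ _ h1, hmono _ _ _ h2⟩
    · exfalso
      refine hj (cornerPt_injective ?_)
      refine reachable_induction h2 (fun y => y = cornerPt i) rfl fun y z hyz _ => ?_
      obtain ⟨h3, h4⟩ := mem_cellE.1 hyz
      exfalso
      rcases Finset.mem_union.1 (Finset.mem_filter.1 h4).2 with h | h <;>
        obtain ⟨e, he, hee⟩ := Finset.mem_image.1 h
      · exact hik (eq_of_map_psi_eq he h3 hee)
      · exact hjk (eq_of_map_psi_eq he h3 hee)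
  · rintro ⟨h1, h2⟩ p hpath e he
    have key : ∀ a, (a = i ∨ a = j) → ∀ x y, (graphOf (cellE n a F)).Reachable x y →
        (graphOf F').Reachable (psi a x) (psi a y) := by
      intro a ha x y hxy
      refine reachable_psi a (fun e he => Finset.mem_filter.2 ⟨(mem_cellE.1 he).2, ?_⟩) hxy
      have := Finset.mem_image_of_mem (Sym2.map (psi a)) (mem_cellE.1 he).1
      rcases ha with rfl | rfl
      exacts [Finset.mem_union_left _ this, Finset.mem_union_right _ this]
    have r1 := key i (.inl rfl) _ _ h1
    have r2 := key j (.inr rfl) _ _ h2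
    rw [psi_cornerPt_self] at r1 r2
    rw [psi_cornerPt_comm] at r1
    obtain ⟨q, hq⟩ := (r1.trans r2).exists_isPath
    have := (hQ.acyclic.subsingleton_path (cornerPt i) (cornerPt j)).elim ⟨p, hpath⟩
      ⟨q.mapLe (graphOf_mono hsub), hq.mapLe _⟩
    have hedges : p.edges = q.edges := by
      simpa using congrArg (fun r => SimpleGraph.Walk.edges r.1) this
    rw [hedges] at he
    induction e with
    | _ x y => exact (Finset.mem_filter.1 (graphOf_adj.1 (q.adj_of_mem_edges he)).1).2

lemma treeClass_succ_disjoint {n : ℕ} {a b : Fin 3} {F : Finset (Sym2 Pt)} (hab : a ≠ b)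
    (ha : F ∈ treeClass (n + 1) a) (hb : F ∈ treeClass (n + 1) b) : False := by
  obtain ⟨hT, ha⟩ := mem_treeClass_succ_iff.1 ha
  obtain ⟨-, hb⟩ := mem_treeClass_succ_iff.1 hb
  obtain ⟨c, hac, hbc⟩ := exists_third a b
  refine not_ring_of_isAcyclic (n := n) (mem_treeSet_iff.1 hT).1.acyclic
    (ring_of_cycle (P := fun i => part (cellE n i F)) (fun _ _ => part_refl _ _) part.symm
      hab.symm hac.symm hbc ?_ ?_ ?_)
  · exact (ha b hab.symm).1.symm.trans (ha c hac.symm).1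
  · exact (hb a hab).1.symm.trans (hb c hbc.symm).1
  · exact (hb c hbc.symm).2.trans (ha c hac.symm).2.symm

lemma exists_mem_treeClass_succ {n : ℕ} {F : Finset (Sym2 Pt)} (hF : F ∈ treeSet (n + 1)) :
    ∃ i, F ∈ treeClass (n + 1) i := by
  obtain ⟨hQ, hp⟩ := mem_treeSet_iff.1 hF
  have hr := ((isCornerForest_succ_iff hQ.subset).1 hQ).2.1
  simp only [ClosedRing, not_forall] at hr
  obtain ⟨a, j, k, hj, hk, hr⟩ := hr
  have hjk : j ≠ k := by
    rintro rfl
    exact hr (part_refl _ _)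
  simp only [part_iff_conn hQ.subset] at hp
  have h1 := (conn_corner_iff hjk hj hk).1 (hp j k)
  have h2 := (conn_corner_iff hj.symm hk.symm hjk).1 (hp a j)
  have h3 := (conn_corner_iff hk.symm hj.symm hjk.symm).1 (hp a k)
  have hno : ¬ (part (cellE n a F) a j ∧ part (cellE n a F) a k) := fun h =>
    hr (h.1.symm.trans h.2)
  obtain ⟨h4, h5⟩ : part (cellE n j F) j k ∧ part (cellE n k F) j k :=
    h1.resolve_right fun h => hr h.2.1
  have c := fin_three_cases hj.symm hk.symm hjk
  have h6 : (part (cellE n a F) a j ∧ part (cellE n j F) a j) ∨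
      (part (cellE n a F) a k ∧ part (cellE n k F) a k) := by
    rcases h2 with h2 | h2
    · exact .inl h2
    · exact .inr (h3.resolve_right fun h3 => hno ⟨h3.1, h2.1⟩)
  rcases h6 with ⟨h6, h7⟩ | ⟨h6, h7⟩
  · refine ⟨j, mem_treeClass_succ_iff.2 ⟨hF, fun x hx => ?_⟩⟩
    rcases c x with rfl | rfl | rfl
    exacts [⟨h7.symm, h6.symm⟩, absurd rfl hx, ⟨h4, h5⟩]
  · refine ⟨k, mem_treeClass_succ_iff.2 ⟨hF, fun x hx => ?_⟩⟩
    rcases c x with rfl | rfl | rfl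
    exacts [⟨h7.symm, h6.symm⟩, ⟨h5.symm, h4.symm⟩, absurd rfl hx]

/-! ### Forests in the triangle `G_0` -/

lemma mem_sierpE_zero {e : Sym2 Pt} :
    e ∈ sierpE 0 ↔ ∃ i j, i ≠ j ∧ s(cornerPt i, cornerPt j) = e := by
  simp only [sierpE, Finset.mem_insert, Finset.mem_singleton]
  constructor
  · rintro (rfl | rfl | rfl)
    exacts [⟨0, 1, by decide, rfl⟩, ⟨1, 2, by decide, rfl⟩, ⟨2, 0, by decide, rfl⟩]
  · rintro ⟨i, j, hij, rfl⟩
    fin_cases i <;> fin_cases j <;> simp at hij ⊢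

/-- The edge between two corners belongs to the edge set. -/
def HasEdge (F : Finset (Sym2 Pt)) (i j : Fin 3) : Prop := s(cornerPt i, cornerPt j) ∈ F

lemma HasEdge.symm {F : Finset (Sym2 Pt)} {i j : Fin 3} (h : HasEdge F i j) : HasEdge F j i := by
  rwa [HasEdge, Sym2.eq_swap]

lemma part_zero_iff {F : Finset (Sym2 Pt)} (hF : F ⊆ sierpE 0) {i j k : Fin 3} (hij : i ≠ j)
    (hik : i ≠ k) (hjk : j ≠ k) :
    part F i j ↔ HasEdge F i j ∨ (HasEdge F i k ∧ HasEdge F k j) := by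
  constructor
  · intro h
    have := reachable_induction h (fun y => ∀ c, cornerPt c = y → c = i ∨
      (c = j ∧ (HasEdge F i j ∨ (HasEdge F i k ∧ HasEdge F k j))) ∨
      (c = k ∧ (HasEdge F i k ∨ (HasEdge F i j ∧ HasEdge F j k))))
      (fun c hc => .inl (cornerPt_injective hc)) ?_ j rfl
    · rcases this with h | ⟨-, h⟩ | ⟨h, -⟩
      exacts [absurd h.symm hij, h, absurd h hjk]
    · intro y z hyz ih c hc
      obtain ⟨a, b, -, hab⟩ := mem_sierpE_zero.1 (hF hyz)
      obtain ⟨d, hd⟩ : ∃ d, cornerPt d = y := by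
        rcases Sym2.eq_iff.1 hab with ⟨h, -⟩ | ⟨-, h⟩
        exacts [⟨a, h⟩, ⟨b, h⟩]
      have hcd := ih d hd
      have hdc : HasEdge F d c := by
        subst hc hd
        exact hyz
      rcases fin_three_cases hij hik hjk c with rfl | rfl | rfl
      · exact .inl rfl
      · refine .inr (.inl ⟨rfl, ?_⟩)
        rcases hcd with rfl | ⟨rfl, h⟩ | ⟨rfl, h | ⟨h, -⟩⟩
        exacts [.inl hdc, h, .inr ⟨h, hdc⟩, .inl h]
      · refine .inr (.inr ⟨rfl, ?_⟩)
        rcases hcd with rfl | ⟨rfl, h | ⟨h, -⟩⟩ | ⟨rfl, h⟩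
        exacts [.inl hdc, .inr ⟨h, hdc⟩, .inl h, h]
  · rintro (h | ⟨h1, h2⟩)
    · exact reachable_of_mem h
    · exact (reachable_of_mem h1).trans (reachable_of_mem h2)

lemma isAcyclic_zero_iff {F : Finset (Sym2 Pt)} (hF : F ⊆ sierpE 0) :
    (graphOf F).IsAcyclic ↔ ∀ i j k, i ≠ j → i ≠ k → j ≠ k →
      HasEdge F i j → HasEdge F i k → HasEdge F k j → False := by
  have key : ∀ {i j k}, i ≠ j → i ≠ k → j ≠ k →
      (part (F.erase s(cornerPt i, cornerPt j)) i j ↔ HasEdge F i k ∧ HasEdge F k j) := by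
    intro i j k hij hik hjk
    have hne := cornerPt_injective.ne_iff.2 hjk
    have hne' := cornerPt_injective.ne_iff.2 hik
    rw [part_zero_iff ((Finset.erase_subset _ _).trans hF) hij hik hjk]
    simp only [HasEdge, Finset.mem_erase, ne_eq, not_true_eq_false, false_and, false_or,
      Sym2.eq_iff]
    simp [hne.symm, hne'.symm, cornerPt_injective.eq_iff, hij, hij.symm]
  rw [isAcyclic_graphOf_iff (ne_of_mem_of_subset hF)]
  constructor
  · intro h i j k hij hik hjk h1 h2 h3
    exact h _ _ h1 ((key hij hik hjk).2 ⟨h2, h3⟩)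
  · intro h x y hxy hr
    obtain ⟨i, j, hij, hmap⟩ := mem_sierpE_zero.1 (hF hxy)
    obtain ⟨k, hik, hjk⟩ := exists_third i j
    rcases Sym2.eq_iff.1 hmap with ⟨rfl, rfl⟩ | ⟨rfl, rfl⟩
    · obtain ⟨h2, h3⟩ := (key hij hik hjk).1 hr
      exact h i j k hij hik hjk hxy h2 h3
    · obtain ⟨h2, h3⟩ := (key hij.symm hjk hik).1 hr
      exact h j i k hij.symm hjk hik hxy h2 h3

lemma isCornerForest_zero_iff {F : Finset (Sym2 Pt)} (hF : F ⊆ sierpE 0) :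
    IsCornerForest 0 F ↔ ∀ i j k, i ≠ j → i ≠ k → j ≠ k →
      HasEdge F i j → HasEdge F i k → HasEdge F k j → False := by
  rw [← isAcyclic_zero_iff hF]
  refine ⟨fun h => h.acyclic, fun h => ⟨hF, h, fun x hx => ?_⟩⟩
  simp only [sierpV, Finset.mem_insert, Finset.mem_singleton] at hx
  rcases hx with rfl | rfl | rfl <;> exact ⟨_, .refl _⟩

lemma eq_of_hasEdge_iff {F F' : Finset (Sym2 Pt)} (hF : F ⊆ sierpE 0) (hF' : F' ⊆ sierpE 0)
    (h : ∀ i j, i ≠ j → (HasEdge F i j ↔ HasEdge F' i j)) : F = F' := by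
  ext e
  constructor
  · intro he
    obtain ⟨i, j, hij, rfl⟩ := mem_sierpE_zero.1 (hF he)
    exact (h i j hij).1 he
  · intro he
    obtain ⟨i, j, hij, rfl⟩ := mem_sierpE_zero.1 (hF' he)
    exact (h i j hij).2 he

/-- The two edges of `G_0` at corner `i`. -/
def starE (i : Fin 3) : Finset (Sym2 Pt) := (sierpE 0).filter fun e => cornerPt i ∈ e

/-- The edge of `G_0` opposite to corner `i`. -/
def oppE (i : Fin 3) : Finset (Sym2 Pt) := (sierpE 0).filter fun e => cornerPt i ∉ e

lemma starE_subset (i : Fin 3) : starE i ⊆ sierpE 0 := Finset.filter_subset _ _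

lemma oppE_subset (i : Fin 3) : oppE i ⊆ sierpE 0 := Finset.filter_subset _ _

lemma hasEdge_starE_iff {i j k : Fin 3} : HasEdge (starE i) j k ↔ j ≠ k ∧ (i = j ∨ i = k) := by
  simp only [HasEdge, starE, Finset.mem_filter, Sym2.mem_iff, cornerPt_injective.eq_iff]
  refine and_congr_left fun _ => ⟨?_, fun h => mem_sierpE_zero.2 ⟨j, k, h, rfl⟩⟩
  rintro h rfl
  exact (sierpE_subset h).2.2 rfl

lemma hasEdge_oppE_iff {i j k : Fin 3} : HasEdge (oppE i) j k ↔ j ≠ k ∧ i ≠ j ∧ i ≠ k := by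
  simp only [HasEdge, oppE, Finset.mem_filter, Sym2.mem_iff, cornerPt_injective.eq_iff, not_or]
  refine and_congr_left fun _ => ⟨?_, fun h => mem_sierpE_zero.2 ⟨j, k, h, rfl⟩⟩
  rintro h rfl
  exact (sierpE_subset h).2.2 rfl

lemma starE_mem_treeSet (i : Fin 3) : starE i ∈ treeSet 0 := by
  refine mem_treeSet_iff.2 ⟨(isCornerForest_zero_iff (starE_subset i)).2 ?_, ?_⟩
  · intro a b c hab hac hbc h1 h2 h3
    rw [hasEdge_starE_iff] at h1 h2 h3
    omega
  · have key : ∀ j, part (starE i) i j := by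
      intro j
      by_cases hij : i = j
      · subst hij
        exact part_refl _ _
      · exact reachable_of_mem (hasEdge_starE_iff.2 ⟨hij, .inl rfl⟩)
    exact fun j k => (key j).symm.trans (key k)

lemma oppE_mem_twoForestSet (i : Fin 3) : oppE i ∈ twoForestSet 0 i := by
  refine mem_twoForestSet_iff.2 ⟨(isCornerForest_zero_iff (oppE_subset i)).2 ?_, ?_, ?_⟩
  · intro a b c hab hac hbc h1 h2 h3
    rw [hasEdge_oppE_iff] at h1 h2 h3
    omega
  · intro j hj h
    obtain ⟨k, hik, hjk⟩ := exists_third i j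
    rw [part_zero_iff (oppE_subset i) hj.symm hik hjk] at h
    simp only [hasEdge_oppE_iff] at h
    omega
  · intro j k hj hk
    by_cases hjk : j = k
    · subst hjk
      exact part_refl _ _
    · exact reachable_of_mem (hasEdge_oppE_iff.2 ⟨hjk, hj.symm, hk.symm⟩)

lemma empty_mem_threeForestSet : ∅ ∈ threeForestSet 0 := by
  have he : ∀ i j, ¬ HasEdge ∅ i j := fun _ _ => Finset.notMem_empty _
  refine mem_threeForestSet_iff.2 ⟨(isCornerForest_zero_iff (Finset.empty_subset _)).2
    fun _ _ _ _ _ _ h _ _ => he _ _ h, fun i j hij h => ?_⟩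
  obtain ⟨k, hik, hjk⟩ := exists_third i j
  rcases (part_zero_iff (Finset.empty_subset _) hij hik hjk).1 h with h | ⟨h, -⟩ <;>
    exact he _ _ h

lemma eq_starE_of_mem_treeSet {F : Finset (Sym2 Pt)} (h : F ∈ treeSet 0) : ∃ i, F = starE i := by
  obtain ⟨hQ, hp⟩ := mem_treeSet_iff.1 h
  have hac := (isCornerForest_zero_iff hQ.subset).1 hQ
  have h01 := (part_zero_iff hQ.subset (i := 0) (j := 1) (k := 2) (by decide) (by decide)
    (by decide)).1 (hp _ _)
  have h02 := (part_zero_iff hQ.subset (i := 0) (j := 2) (k := 1) (by decide) (by decide)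
    (by decide)).1 (hp _ _)
  have key : ∃ i j k, i ≠ j ∧ i ≠ k ∧ j ≠ k ∧ HasEdge F i j ∧ HasEdge F i k := by
    rcases h01 with h | ⟨h, h'⟩
    · rcases h02 with h' | ⟨-, h'⟩
      · exact ⟨0, 1, 2, by decide, by decide, by decide, h, h'⟩
      · exact ⟨1, 0, 2, by decide, by decide, by decide, h.symm, h'⟩
    · exact ⟨2, 0, 1, by decide, by decide, by decide, h.symm, h'⟩
  obtain ⟨i, j, k, hij, hik, hjk, h1, h2⟩ := key
  have h3 : ¬ HasEdge F j k := fun h3 => hac i j k hij hik hjk h1 h2 h3.symm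
  refine ⟨i, eq_of_hasEdge_iff hQ.subset (starE_subset i) fun a b hab => ?_⟩
  rw [hasEdge_starE_iff]
  have c := fin_three_cases hij hik hjk
  have h1' := h1.symm
  have h2' := h2.symm
  have h3' : ¬ HasEdge F k j := fun h => h3 h.symm
  rcases c a with rfl | rfl | rfl <;> rcases c b with rfl | rfl | rfl <;> first
    | exact absurd rfl hab
    | exact iff_of_true (by assumption) ⟨hab, .inl rfl⟩
    | exact iff_of_true (by assumption) ⟨hab, .inr rfl⟩
    | exact iff_of_false (by assumption) (by omega)

lemma eq_oppE_of_mem_twoForestSet {F : Finset (Sym2 Pt)} {i : Fin 3} (h : F ∈ twoForestSet 0 i) :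
    F = oppE i := by
  obtain ⟨hQ, hn, hp⟩ := mem_twoForestSet_iff.1 h
  have hno : ∀ j, j ≠ i → ¬ HasEdge F i j := fun j hj h => hn j hj (reachable_of_mem h)
  refine eq_of_hasEdge_iff hQ.subset (oppE_subset i) fun a b hab => ?_
  rw [hasEdge_oppE_iff]
  by_cases ha : i = a
  · subst ha
    exact iff_of_false (hno b hab.symm) fun h => h.2.1 rfl
  by_cases hb : i = b
  · subst hb
    exact iff_of_false (fun h => hno a hab h.symm) fun h => h.2.2 rfl
  refine iff_of_true ?_ ⟨hab, ha, hb⟩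
  rcases (part_zero_iff hQ.subset hab (Ne.symm ha) (Ne.symm hb)).1
    (hp a b (Ne.symm ha) (Ne.symm hb)) with h | ⟨-, h⟩
  exacts [h, absurd h (hno b (Ne.symm hb))]

lemma eq_empty_of_mem_threeForestSet {F : Finset (Sym2 Pt)} (h : F ∈ threeForestSet 0) :
    F = ∅ := by
  obtain ⟨hQ, hn⟩ := mem_threeForestSet_iff.1 h
  exact eq_of_hasEdge_iff hQ.subset (Finset.empty_subset _) fun a b hab =>
    iff_of_false (fun h => hn a b hab (reachable_of_mem h)) (Finset.notMem_empty _)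

/-! ### Existence of forests of each class in `G_1` -/

lemma exists_isCornerForest_zero (j : Fin 3) : ∃ F, IsCornerForest 0 F ∧
    ∀ b c, part F b c ↔ (b = j ↔ c = j) := by
  obtain ⟨hQ, hn, hp⟩ := mem_twoForestSet_iff.1 (oppE_mem_twoForestSet j)
  refine ⟨oppE j, hQ, fun b c => ?_⟩
  by_cases hb : b = j
  · subst hb
    by_cases hc : c = b
    · subst hc
      exact iff_of_true (part_refl _ _) Iff.rfl
    · exact iff_of_false (hn c hc) fun h => hc (h.1 rfl)
  · by_cases hc : c = j
    · subst hc
      exact iff_of_false (fun h => hn b hb h.symm) fun h => hb (h.2 rfl)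
    · exact iff_of_true (hp _ _ hb hc) (iff_of_false hb hc)

lemma treeClass_one_nonempty (i : Fin 3) : (treeClass 1 i).Nonempty := by
  obtain ⟨j, hij, -⟩ := exists_third i i
  obtain ⟨k, hik, hjk⟩ := exists_third i j
  obtain ⟨F, hF, hFp⟩ := exists_isCornerForest_zero k
  obtain ⟨hS, hSp⟩ := mem_treeSet_iff.1 (starE_mem_treeSet i)
  have c := fin_three_cases hij hik hjk
  let f : Fin 3 → Finset (Sym2 Pt) := fun a => if a = j then F else starE i
  have hf : ∀ a, IsCornerForest 0 (f a) := by
    intro a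
    simp only [f]
    split_ifs
    exacts [hF, hS]
  have hfj : ∀ b c, part (f j) b c ↔ (b = k ↔ c = k) := by simpa [f] using hFp
  have hfi : ∀ a, a ≠ j → ∀ b c, part (f a) b c := by
    intro a ha
    simpa [f, ha] using hSp
  have h1 : part (f j) i j := (hfj i j).2 (iff_of_false hik hjk)
  have hconn : ∀ x, x ≠ i → part (f i) i x ∧ part (f x) i x := by
    intro x hx
    refine ⟨hfi i hij _ _, ?_⟩
    rcases c x with rfl | rfl | rfl
    exacts [absurd rfl hx, h1, hfi _ hjk.symm _ _]
  have hQ : IsCornerForest 1 (glueE f) := by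
    refine (isCornerForest_glueE_iff hf).2 ⟨fun h => ?_, fun a b => ?_⟩
    · have := (hfj i k).1 (h j i k hij hjk.symm)
      exact hik (this.2 rfl)
    · by_cases ha : a = j
      · subst ha
        by_cases hb : b = k
        · subst hb
          exact ⟨b, .inr ⟨hjk, .inl ⟨hfi b hjk.symm _ _, part_refl _ _⟩⟩⟩
        · exact ⟨a, .inl ⟨rfl, .inl ((hfj a b).2 (iff_of_false hjk hb))⟩⟩
      · exact ⟨a, .inl ⟨rfl, .inl (hfi a ha _ _)⟩⟩
  refine ⟨glueE f, mem_treeClass_succ_iff.2 ⟨mem_treeSet_iff.2 ⟨hQ, ?_⟩, ?_⟩⟩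
  · have key : ∀ x, part (glueE f) i x := by
      intro x
      by_cases hx : x = i
      · subst hx
        exact part_refl _ _
      · exact (part_glueE_iff hf).2 (.inr ⟨hx, .inl (hconn x hx)⟩)
    exact fun x y => (key x).symm.trans (key y)
  · simpa only [cellE_glueE fun i => (hf i).subset] using hconn

lemma twoForestSet_one_nonempty (i : Fin 3) : (twoForestSet 1 i).Nonempty := by
  obtain ⟨hS, hSp⟩ := mem_treeSet_iff.1 (starE_mem_treeSet i)
  obtain ⟨hR, hRp⟩ := mem_threeForestSet_iff.1 empty_mem_threeForestSet
  let f : Fin 3 → Finset (Sym2 Pt) := fun a => if a = i then ∅ else starE i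
  have hf : ∀ a, IsCornerForest 0 (f a) := by
    intro a
    simp only [f]
    split_ifs
    exacts [hR, hS]
  have hfi : ∀ b c, b ≠ c → ¬ part (f i) b c := by simpa [f] using hRp
  have hfj : ∀ a, a ≠ i → ∀ b c, part (f a) b c := by
    intro a ha
    simpa [f, ha] using hSp
  refine ⟨glueE f, mem_twoForestSet_iff.2
    ⟨(isCornerForest_glueE_iff hf).2 ⟨fun h => ?_, fun a b => ?_⟩, fun j hj h => ?_,
      fun j k hj hk => ?_⟩⟩
  · obtain ⟨j, hij, -⟩ := exists_third i i
    obtain ⟨k, hik, hjk⟩ := exists_third i j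
    exact hfi j k hjk (h i j k hij.symm hik.symm)
  · by_cases ha : a = i
    · subst ha
      by_cases hb : b = a
      · subst hb
        exact ⟨b, .inl ⟨rfl, .inl (part_refl _ _)⟩⟩
      · exact ⟨b, .inr ⟨Ne.symm hb, .inl ⟨hfj b hb _ _, part_refl _ _⟩⟩⟩
    · exact ⟨a, .inl ⟨rfl, .inl (hfj a ha _ _)⟩⟩
  · obtain ⟨k, hik, hjk⟩ := exists_third i j
    rcases (conn_corner_iff hj.symm hik hjk).1 ((part_glueE_iff hf).1 h) with ⟨h, -⟩ | ⟨h, -⟩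
    exacts [hfi _ _ hj.symm h, hfi _ _ hik h]
  · by_cases hjk : j = k
    · subst hjk
      exact part_refl _ _
    · exact (part_glueE_iff hf).2 (.inr ⟨Ne.symm hjk, .inl ⟨hfj j hj _ _, hfj k hk _ _⟩⟩)

lemma threeForestSet_one_nonempty : (threeForestSet 1).Nonempty := by
  choose f hf hfp using fun a : Fin 3 => exists_isCornerForest_zero (a + 2)
  refine ⟨glueE f, mem_threeForestSet_iff.2
    ⟨(isCornerForest_glueE_iff hf).2 ⟨fun h => ?_, fun a b => ?_⟩, fun j k hjk h => ?_⟩⟩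
  · have := (hfp 0 1 2).1 (h 0 1 2 (by decide) (by decide))
    revert this
    decide
  · by_cases hb : b = a + 2
    · refine ⟨b, .inr ⟨by omega, .inl ⟨(hfp b b a).2 (by omega), part_refl _ _⟩⟩⟩
    · exact ⟨a, .inl ⟨rfl, .inl ((hfp a a b).2 (by omega))⟩⟩
  · obtain ⟨l, hjl, hkl⟩ := exists_third j k
    have := (conn_corner_iff hjk hjl hkl).1 ((part_glueE_iff hf).1 h)
    simp only [hfp] at this
    omega

/-! ### The trace -/

lemma traceCell_of_mem_treeClass {g : Finset (Sym2 Pt)} {i : Fin 3} (h : g ∈ treeClass 1 i) :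
    traceCell g = starE i := by
  have hno : ∀ j, j ≠ i → g ∉ treeClass 1 j := fun j hj hg => treeClass_succ_disjoint hj hg h
  unfold traceCell
  fin_cases i
  · exact if_pos h
  · rw [if_neg (hno 0 (by decide))]; exact if_pos h
  · rw [if_neg (hno 0 (by decide)), if_neg (hno 1 (by decide))]; exact if_pos h

lemma notMem_treeClass {g : Finset (Sym2 Pt)} (h : ∃ j k, ¬ part g j k) (i : Fin 3) :
    g ∉ treeClass 1 i := by
  obtain ⟨j, k, h⟩ := h
  exact fun hg => h ((mem_treeSet_iff.1 (mem_treeClass_succ_iff.1 hg).1).2 j k)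

lemma traceCell_of_mem_twoForestSet {g : Finset (Sym2 Pt)} {i : Fin 3}
    (h : g ∈ twoForestSet 1 i) : traceCell g = oppE i := by
  obtain ⟨-, h1, h2⟩ := mem_twoForestSet_iff.1 h
  obtain ⟨j, hij, -⟩ := exists_third i i
  have hT := notMem_treeClass ⟨i, j, h1 j hij.symm⟩
  have hno : ∀ j, j ≠ i → g ∉ twoForestSet 1 j := by
    intro j hj hg
    obtain ⟨k, hik, hjk⟩ := exists_third i j
    exact (mem_twoForestSet_iff.1 hg).2.1 k hjk.symm (h2 j k hj hik.symm)
  unfold traceCell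
  rw [if_neg (hT 0), if_neg (hT 1), if_neg (hT 2)]
  fin_cases i
  · exact if_pos h
  · rw [if_neg (hno 0 (by decide))]; exact if_pos h
  · rw [if_neg (hno 0 (by decide)), if_neg (hno 1 (by decide))]; exact if_pos h

lemma traceCell_of_mem_threeForestSet {g : Finset (Sym2 Pt)} (h : g ∈ threeForestSet 1) :
    traceCell g = ∅ := by
  obtain ⟨-, h1⟩ := mem_threeForestSet_iff.1 h
  have hT := notMem_treeClass ⟨0, 1, h1 0 1 (by decide)⟩
  have hno : ∀ j, g ∉ twoForestSet 1 j := by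
    intro j hg
    obtain ⟨k, hjk, -⟩ := exists_third j j
    obtain ⟨l, hjl, hkl⟩ := exists_third j k
    exact h1 k l hkl ((mem_twoForestSet_iff.1 hg).2.2 k l hjk.symm hjl.symm)
  unfold traceCell
  rw [if_neg (hT 0), if_neg (hT 1), if_neg (hT 2), if_neg (hno 0), if_neg (hno 1),
    if_neg (hno 2)]

lemma traceCell_subset (g : Finset (Sym2 Pt)) : traceCell g ⊆ sierpE 0 := by
  unfold traceCell
  split_ifs <;> first | exact Finset.filter_subset _ _ | exact Finset.empty_subset _

lemma psiWord_nil (w : Fin 0 → Fin 3) : psiWord w = id := by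
  simp [psiWord]

lemma psiWord_cons {k : ℕ} (i : Fin 3) (w : Fin k → Fin 3) :
    psiWord (Fin.cons i w : Fin (k + 1) → Fin 3) = psi i ∘ psiWord w := by
  simp [psiWord, List.ofFn_succ]

lemma map_psiWord_cons {k : ℕ} (i : Fin 3) (w : Fin k → Fin 3) (e : Sym2 Pt) :
    Sym2.map (psiWord (Fin.cons i w : Fin (k + 1) → Fin 3)) e =
      Sym2.map (psi i) (Sym2.map (psiWord w) e) := by
  rw [psiWord_cons, Sym2.map_map]

lemma map_psiWord_mem {k n : ℕ} (w : Fin k → Fin 3) {e : Sym2 Pt} (he : e ∈ sierpE n) :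
    Sym2.map (psiWord w) e ∈ sierpE (n + k) := by
  induction k with
  | zero => simpa [psiWord_nil] using he
  | succ k ih =>
    induction w using Fin.consCases with
    | _ i w =>
      rw [map_psiWord_cons]
      exact mem_sierpE_succ.2 ⟨i, _, ih w, rfl⟩

lemma restrictE_nil (w : Fin 0 → Fin 3) {n : ℕ} {F : Finset (Sym2 Pt)} (hF : F ⊆ sierpE n) :
    restrictE w n F = F := by
  ext e
  simpa [restrictE, psiWord_nil] using fun h => hF h

lemma restrictE_cons {k n : ℕ} (hk : k ≤ n) (i : Fin 3) (w : Fin k → Fin 3)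
    (F : Finset (Sym2 Pt)) :
    restrictE (Fin.cons i w : Fin (k + 1) → Fin 3) (n + 1) F = restrictE w n (cellE n i F) := by
  ext e
  simp only [restrictE, Finset.mem_filter, mem_cellE, map_psiWord_cons, Nat.add_sub_add_right]
  refine and_congr_right fun he => (and_iff_right ?_).symm
  have := map_psiWord_mem w he
  rwa [Nat.sub_add_cancel hk] at this

lemma IsCornerForest.restrictE {k n : ℕ} (hk : k ≤ n) (w : Fin k → Fin 3)
    {F : Finset (Sym2 Pt)} (hF : IsCornerForest n F) :
    IsCornerForest (n - k) (restrictE w n F) := by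
  induction k generalizing n F with
  | zero => rwa [restrictE_nil w hF.subset]
  | succ k ih =>
    obtain ⟨n, rfl⟩ : ∃ m, n = m + 1 := ⟨n - 1, by omega⟩
    induction w using Fin.consCases with
    | _ i w =>
      rw [restrictE_cons (by omega), Nat.add_sub_add_right]
      exact ih (by omega) w (((isCornerForest_succ_iff hF.subset).1 hF).1 i)

lemma trace_zero {f : Finset (Sym2 Pt)} (hf : f ⊆ sierpE 1) : trace 0 f = traceCell f := by
  ext e
  simp [trace, psiWord_nil, restrictE_nil _ hf]

lemma mem_trace {n : ℕ} {f : Finset (Sym2 Pt)} {e : Sym2 Pt} :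
    e ∈ trace n f ↔ ∃ w : Fin n → Fin 3, ∃ e' ∈ traceCell (restrictE w (n + 1) f),
      Sym2.map (psiWord w) e' = e := by
  simp [trace]

lemma trace_subset (n : ℕ) (f : Finset (Sym2 Pt)) : trace n f ⊆ sierpE n := by
  intro e he
  obtain ⟨w, e', he', rfl⟩ := mem_trace.1 he
  have := map_psiWord_mem w (traceCell_subset _ he')
  rwa [Nat.zero_add] at this

lemma trace_succ (n : ℕ) (f : Finset (Sym2 Pt)) :
    trace (n + 1) f = glueE fun i => trace n (cellE (n + 1) i f) := by
  ext e
  simp only [mem_glueE, mem_trace]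
  constructor
  · rintro ⟨w, e', he', rfl⟩
    induction w using Fin.consCases with
    | _ i w =>
      rw [restrictE_cons (by omega)] at he'
      exact ⟨i, _, ⟨w, e', he', rfl⟩, (map_psiWord_cons i w e').symm⟩
  · rintro ⟨i, _, ⟨w, e', he', rfl⟩, rfl⟩
    refine ⟨Fin.cons i w, e', ?_, map_psiWord_cons i w e'⟩
    rwa [restrictE_cons (by omega)]

lemma cellE_trace (n : ℕ) (i : Fin 3) (f : Finset (Sym2 Pt)) :
    cellE n i (trace (n + 1) f) = trace n (cellE (n + 1) i f) := by
  rw [trace_succ, cellE_glueE fun _ => trace_subset _ _]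

/-- The trace of a corner forest is a corner forest with the same connection pattern. -/
lemma IsCornerForest.trace {n : ℕ} {f : Finset (Sym2 Pt)} (hf : IsCornerForest (n + 1) f) :
    IsCornerForest n (trace n f) ∧ part (_root_.trace n f) = part f := by
  induction n generalizing f with
  | zero =>
    rw [trace_zero hf.subset]
    rcases hf.cases with h | ⟨i, h⟩ | h
    · obtain ⟨i, hi⟩ := exists_mem_treeClass_succ h
      have hs := starE_mem_treeSet i
      rw [traceCell_of_mem_treeClass hi]
      exact ⟨(mem_treeSet_iff.1 hs).1, funext₂ fun j k => propext (part_iff_of_mem_treeSet hs h j k)⟩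
    · have hs := oppE_mem_twoForestSet i
      rw [traceCell_of_mem_twoForestSet h]
      exact ⟨(mem_twoForestSet_iff.1 hs).1,
        funext₂ fun j k => propext (part_iff_of_mem_twoForestSet hs h j k)⟩
    · have hs := empty_mem_threeForestSet
      rw [traceCell_of_mem_threeForestSet h]
      exact ⟨(mem_threeForestSet_iff.1 hs).1,
        funext₂ fun j k => propext (part_iff_of_mem_threeForestSet hs h j k)⟩
  | succ n ih =>
    obtain ⟨h1, h2⟩ := (isCornerForest_succ_iff hf.subset).1 hf
    have hsub := trace_subset (n + 1) f
    have hp : (fun i => part (cellE n i (_root_.trace (n + 1) f))) =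
        fun i => part (cellE (n + 1) i f) := by
      funext i
      rw [cellE_trace, (ih (h1 i)).2]
    refine ⟨(isCornerForest_succ_iff hsub).2 ⟨fun i => ?_, ?_⟩, ?_⟩
    · rw [cellE_trace]
      exact (ih (h1 i)).1
    · rwa [hp]
    · funext j k
      rw [part_iff_conn hsub, part_iff_conn hf.subset, hp]

lemma exists_trace_eq {n : ℕ} {g : Finset (Sym2 Pt)} (hg : IsCornerForest n g) :
    ∃ f, IsCornerForest (n + 1) f ∧ trace n f = g := by
  induction n generalizing g with
  | zero =>
    suffices ∃ f, IsCornerForest 1 f ∧ traceCell f = g by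
      obtain ⟨f, hf, h⟩ := this
      exact ⟨f, hf, (trace_zero hf.subset).trans h⟩
    rcases hg.cases with h | ⟨i, h⟩ | h
    · obtain ⟨i, rfl⟩ := eq_starE_of_mem_treeSet h
      obtain ⟨f, hf⟩ := treeClass_one_nonempty i
      exact ⟨f, (mem_treeSet_iff.1 (mem_treeClass_succ_iff.1 hf).1).1,
        traceCell_of_mem_treeClass hf⟩
    · obtain ⟨f, hf⟩ := twoForestSet_one_nonempty i
      exact ⟨f, (mem_twoForestSet_iff.1 hf).1,
        (traceCell_of_mem_twoForestSet hf).trans (eq_oppE_of_mem_twoForestSet h).symm⟩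
    · obtain ⟨f, hf⟩ := threeForestSet_one_nonempty
      exact ⟨f, (mem_threeForestSet_iff.1 hf).1,
        (traceCell_of_mem_threeForestSet hf).trans (eq_empty_of_mem_threeForestSet h).symm⟩
  | succ n ih =>
    obtain ⟨h1, h2⟩ := (isCornerForest_succ_iff hg.subset).1 hg
    choose f hf hfg using fun i => ih (h1 i)
    refine ⟨glueE f, (isCornerForest_glueE_iff hf).2 ?_, ?_⟩
    · have hp : (fun i => part (f i)) = fun i => part (cellE n i g) := by
        funext i
        rw [← hfg i, (hf i).trace.2]
      rwa [hp]
    · rw [trace_succ, ← glueE_cellE hg.subset]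
      simp only [cellE_glueE fun i => (hf i).subset, hfg]

/-- The trace maps a class of corner forests determined by the connection pattern onto the
corresponding class. -/
lemma image_trace_eq {n : ℕ} {A B : Finset (Finset (Sym2 Pt))}
    (p : (Fin 3 → Fin 3 → Prop) → Prop)
    (hA : ∀ F, F ∈ A ↔ IsCornerForest (n + 1) F ∧ p (part F))
    (hB : ∀ F, F ∈ B ↔ IsCornerForest n F ∧ p (part F)) :
    A.image (trace n) = B := by
  ext g
  rw [Finset.mem_image, hB]
  constructor
  · rintro ⟨f, hf, rfl⟩
    obtain ⟨h1, h2⟩ := (hA f).1 hf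
    exact ⟨h1.trace.1, by rwa [h1.trace.2]⟩
  · rintro ⟨h1, h2⟩
    obtain ⟨f, hf, rfl⟩ := exists_trace_eq h1
    exact ⟨f, (hA f).2 ⟨hf, by rwa [← hf.trace.2]⟩, rfl⟩

lemma trace_mem_treeClass_iff {n : ℕ} {i : Fin 3} {f : Finset (Sym2 Pt)}
    (hf : IsCornerForest (n + 1 + 1) f) :
    trace (n + 1) f ∈ treeClass (n + 1) i ↔ f ∈ treeClass (n + 1 + 1) i := by
  have h1 := ((isCornerForest_succ_iff hf.subset).1 hf).1
  simp only [mem_treeClass_succ_iff, mem_treeSet_iff, cellE_trace, (h1 _).trace.2, hf.trace.2,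
    hf, hf.trace.1]

lemma image_trace_treeClass (n : ℕ) (i : Fin 3) :
    (treeClass (n + 1) i).image (trace n) = treeClass n i := by
  have hQ : ∀ {n F}, F ∈ treeClass (n + 1) i → IsCornerForest (n + 1) F := fun h =>
    (mem_treeSet_iff.1 (mem_treeClass_succ_iff.1 h).1).1
  ext g
  rw [Finset.mem_image]
  cases n with
  | zero =>
    have h0 : g ∈ treeClass 0 i ↔ g = starE i := Finset.mem_singleton
    have key : ∀ f ∈ treeClass 1 i, trace 0 f = starE i := fun f hf =>
      (trace_zero (hQ hf).subset).trans (traceCell_of_mem_treeClass hf)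
    rw [h0]
    constructor
    · rintro ⟨f, hf, rfl⟩
      exact key f hf
    · rintro rfl
      obtain ⟨f, hf⟩ := treeClass_one_nonempty i
      exact ⟨f, hf, key f hf⟩
  | succ n =>
    constructor
    · rintro ⟨f, hf, rfl⟩
      exact (trace_mem_treeClass_iff (hQ hf)).2 hf
    · intro hg
      obtain ⟨f, hf, rfl⟩ := exists_trace_eq (hQ hg)
      exact ⟨f, (trace_mem_treeClass_iff hf).1 hg, rfl⟩

/-- restrictions of elements of `Q_{n+1}` lie in `Q_{n+1-k}`, the trace of an
element of `Q_{n+1}` lies in `Q_n`, and the trace maps each class onto the corresponding class. -/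
theorem restriction_and_trace (n : ℕ) :
    (∀ f ∈ qSet (n + 1),
        (∀ k : ℕ, k ≤ n + 1 → ∀ w : Fin k → Fin 3,
            restrictE w (n + 1) f ∈ qSet (n + 1 - k)) ∧
          trace n f ∈ qSet n) ∧
      (∀ i : Fin 3, (treeClass (n + 1) i).image (trace n) = treeClass n i) ∧
      (∀ i : Fin 3, (twoForestSet (n + 1) i).image (trace n) = twoForestSet n i) ∧
      (threeForestSet (n + 1)).image (trace n) = threeForestSet n := by
  refine ⟨fun f hf => ?_, image_trace_treeClass n, fun i => ?_, ?_⟩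
  · have hQ := mem_qSet_iff.1 hf
    exact ⟨fun k hk w => mem_qSet_iff.2 (hQ.restrictE hk w), mem_qSet_iff.2 hQ.trace.1⟩
  · exact image_trace_eq (fun P => (∀ j, j ≠ i → ¬ P i j) ∧ ∀ j k, j ≠ i → k ≠ i → P j k)
      (fun _ => mem_twoForestSet_iff) fun _ => mem_twoForestSet_iff
  · exact image_trace_eq (fun P => ∀ j k, j ≠ k → ¬ P j k)
      (fun _ => mem_threeForestSet_iff) fun _ => mem_threeForestSet_iff

end
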